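/- Let X be a compact Hausdorff space, A a separable unital C(X)-algebra, and p ∈ A a projection such that for every x ∈ X the image p_x of p in the fibre A_x = A/I_x is a nonzero properly infinite projection; concretely, for every x ∈ X one has p ∉ I_x and there exist v, w ∈ A with v*v − p ∈ I_x, w*w − p ∈ I_x, pv − v ∈ I_x, pw − w ∈ I_x and v*w ∈ I_x. Then there exists a positive integer l such that the projection P = diag(p, p, ..., p) ∈ M_l(A) (the direct sum of l copies of p) is properly infinite: there exist V, W ∈ M_l(A) with V*V = P, W*W = P, PV = V, PW = W and V*W = 0. -/

import Mathlib

/-- The fibre ideal `I_x` of a `C(X)`-algebra `A` with structure map `Φ : C(X) → A` at a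
point `x ∈ X`: the closure of the set of finite sums of elements `Φ(f) * a` with
`f x = 0` and `a ∈ A`. -/
def fiberIdeal {X : Type*} [TopologicalSpace X] {A : Type*} [CStarAlgebra A]
    (Φ : C(X, ℂ) →⋆ₐ[ℂ] A) (x : X) : Set A :=
  closure (AddSubmonoid.closure
    {c : A | ∃ (f : C(X, ℂ)) (a : A), f x = 0 ∧ c = Φ f * a} : Set A)

/-- `a` is small near `x`. -/
def SmallAt {X : Type*} [TopologicalSpace X] [CompactSpace X] {A : Type*} [CStarAlgebra A]
    (Φ : C(X, ℂ) →⋆ₐ[ℂ] A) (x : X) (a : A) : Prop :=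
  ∀ ε : ℝ, 0 < ε → ∃ U : Set X, U ∈ nhds x ∧ ∀ h : C(X, ℂ), ‖h‖ ≤ 1 →
    (∀ y, y ∉ U → h y = 0) → ‖Φ h * a‖ < ε

section
variable {X : Type*} [TopologicalSpace X] [CompactSpace X] {A : Type*} [CStarAlgebra A]
    {Φ : C(X, ℂ) →⋆ₐ[ℂ] A} {x : X}

lemma phi_norm_le (h : C(X, ℂ)) : ‖Φ h‖ ≤ ‖h‖ :=
  NonUnitalStarAlgHom.norm_apply_le Φ h

lemma SmallAt.add {a b : A} (ha : SmallAt Φ x a) (hb : SmallAt Φ x b) : SmallAt Φ x (a + b) := by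
  intro ε hε
  obtain ⟨U, hU, h1⟩ := ha (ε/2) (by positivity)
  obtain ⟨V, hV, h2⟩ := hb (ε/2) (by positivity)
  refine ⟨U ∩ V, Filter.inter_mem hU hV, fun h hn h0 => ?_⟩
  have e1 := h1 h hn (fun y hy => h0 y (fun hh => hy hh.1))
  have e2 := h2 h hn (fun y hy => h0 y (fun hh => hy hh.2))
  rw [mul_add]
  linarith [norm_add_le (Φ h * a) (Φ h * b)]

lemma SmallAt.mul (hΦ : ∀ f : C(X, ℂ), ∀ a : A, Φ f * a = a * Φ f)
    {a : A} (b c : A) (ha : SmallAt Φ x a) : SmallAt Φ x (b * a * c) := by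
  intro ε hε
  obtain ⟨U, hU, h1⟩ := ha (ε/(‖b‖ * ‖c‖ + 1)) (by positivity)
  refine ⟨U, hU, fun h hn h0 => ?_⟩
  have e1 := h1 h hn h0
  have : Φ h * (b * a * c) = b * (Φ h * a) * c := by
    rw [← mul_assoc, ← mul_assoc, hΦ h b]; simp only [mul_assoc]
  rw [this]
  have hpos : 0 < ‖b‖ * ‖c‖ + 1 := by positivity
  rw [lt_div_iff₀ hpos] at e1
  calc ‖b * (Φ h * a) * c‖ ≤ ‖b‖ * ‖Φ h * a‖ * ‖c‖ :=
        (norm_mul_le _ _).trans (by gcongr; exact norm_mul_le _ _)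
    _ ≤ ‖Φ h * a‖ * (‖b‖ * ‖c‖ + 1) := by nlinarith [norm_nonneg (Φ h * a)]
    _ < ε := e1

lemma SmallAt.mul_left (hΦ : ∀ f : C(X, ℂ), ∀ a : A, Φ f * a = a * Φ f)
    {a : A} (b : A) (ha : SmallAt Φ x a) : SmallAt Φ x (b * a) := by
  simpa using ha.mul hΦ b 1

lemma smallAt_of_mem (hΦ : ∀ f : C(X, ℂ), ∀ a : A, Φ f * a = a * Φ f)
    {a : A} (ha : a ∈ fiberIdeal Φ x) : SmallAt Φ x a := by
  have key : ∀ b ∈ AddSubmonoid.closure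
      {c : A | ∃ (f : C(X, ℂ)) (a : A), f x = 0 ∧ c = Φ f * a}, SmallAt Φ x b := by
    intro b hb
    induction hb using AddSubmonoid.closure_induction with
    | mem b hb =>
      obtain ⟨f, a, hf, rfl⟩ := hb
      have : SmallAt Φ x (Φ f) := by
        intro ε hε
        refine ⟨{y | ‖f y‖ < ε / 2}, ?_, fun h hn h0 => ?_⟩
        · apply (isOpen_lt (by fun_prop) continuous_const).mem_nhds
          simp [hf, hε]
        · rw [← map_mul]
          refine (phi_norm_le _).trans_lt (lt_of_le_of_lt ?_ (half_lt_self hε))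
          rw [ContinuousMap.norm_le _ (by positivity)]
          intro y
          by_cases hy : ‖f y‖ < ε / 2
          · have := (h.norm_coe_le_norm y).trans hn
            simp only [ContinuousMap.mul_apply, norm_mul]
            nlinarith [norm_nonneg (f y)]
          · simp only [ContinuousMap.mul_apply, norm_mul, h0 y hy, norm_zero, zero_mul]
            positivity
      simpa using this.mul hΦ 1 a
    | zero => exact fun ε hε => ⟨Set.univ, Filter.univ_mem, fun h _ _ => by simpa using hε⟩
    | add a b _ _ ha hb => exact ha.add hb
  intro ε hε
  obtain ⟨b, hb, hab⟩ := Metric.mem_closure_iff.1 ha (ε/2) (by positivity)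
  obtain ⟨U, hU, h1⟩ := key b hb (ε/2) (by positivity)
  refine ⟨U, hU, fun h hn h0 => ?_⟩
  have e1 := h1 h hn h0
  have : Φ h * a = Φ h * (a - b) + Φ h * b := by rw [← mul_add]; simp
  rw [this]
  rw [dist_eq_norm] at hab
  have e2 : ‖Φ h * (a - b)‖ ≤ ‖a - b‖ := by
    refine (norm_mul_le _ _).trans ?_
    have := (phi_norm_le (Φ := Φ) h).trans hn
    nlinarith [norm_nonneg (a - b)]
  linarith [norm_add_le (Φ h * (a - b)) (Φ h * b)]

lemma cutoff [T2Space X] {U : Set X} (hU : U ∈ nhds x) : ∃ V : Set X, IsOpen V ∧ x ∈ V ∧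
    ∃ h : C(X, ℂ), star h = h ∧ ‖h‖ ≤ 1 ∧ (∀ y ∈ V, h y = 1) ∧ (∀ y, y ∉ U → h y = 0) := by
  obtain ⟨K, hK, hKc, hKU⟩ := exists_mem_nhds_isClosed_subset (interior_mem_nhds.2 hU)
  obtain ⟨f, hf0, hf1, hf⟩ := exists_continuous_zero_one_of_isClosed
    (s := (interior U)ᶜ) (t := K) isOpen_interior.isClosed_compl hKc
    (Set.disjoint_left.2 fun y hy hy' => hy (hKU hy'))
  refine ⟨interior K, isOpen_interior, mem_interior_iff_mem_nhds.2 hK,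
    ⟨fun y => (f y : ℂ), by fun_prop⟩, ?_, ?_, ?_, ?_⟩
  · ext y; simp
  · rw [ContinuousMap.norm_le _ zero_le_one]
    intro y
    simp only [ContinuousMap.coe_mk, Complex.norm_real, Real.norm_eq_abs]
    rw [abs_le]; constructor <;> linarith [(hf y).1, (hf y).2]
  · intro y hy
    simp [hf1 (interior_subset hy)]
  · intro y hy
    have : y ∈ (interior U)ᶜ := fun h => hy (interior_subset h)
    simp [hf0 this]

lemma inv_sqrt (b p : A) (hb : star b = b) (hn : ‖b - 1‖ < 1) (hp : b * p = p * b) :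
    ∃ c : A, star c = c ∧ c * p = p * c ∧ c * b * c = 1 := by
  have hsa : IsSelfAdjoint b := hb
  have hpos : ∀ t ∈ spectrum ℝ b, 0 < t := by
    intro t ht
    have h1 : t - 1 ∈ spectrum ℝ (b - 1) := by
      have := (spectrum.sub_singleton_eq b (1:ℝ))
      rw [map_one] at this
      rw [← this]
      exact Set.sub_mem_sub ht rfl
    have h2 := spectrum.norm_le_norm_mul_of_mem h1
    have h3 : ‖(1 : A)‖ ≤ 1 := by
      rcases subsingleton_or_nontrivial A with h | h
      · rw [Subsingleton.elim (1:A) 0]; simp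
      · simp
    have h4 : ‖t - 1‖ < 1 := by nlinarith [norm_nonneg (b - 1)]
    rw [Real.norm_eq_abs, abs_lt] at h4
    linarith
  have hc : ContinuousOn (fun t : ℝ => (√t)⁻¹) (spectrum ℝ b) :=
    ContinuousOn.inv₀ (by fun_prop) (fun t ht => (Real.sqrt_pos.2 (hpos t ht)).ne')
  refine ⟨cfc (fun t : ℝ => (√t)⁻¹) b, cfc_predicate (fun t : ℝ => (√t)⁻¹) b, ?_, ?_⟩
  · exact (Commute.cfc_real (show Commute b p from hp) _).eq
  · conv_lhs => rw [show cfc (fun t : ℝ => (√t)⁻¹) b * b * cfc (fun t : ℝ => (√t)⁻¹) b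
      = cfc (fun t : ℝ => (√t)⁻¹) b * cfc (fun t : ℝ => t) b * cfc (fun t : ℝ => (√t)⁻¹) b by
        rw [cfc_id' ℝ b]]
    rw [← cfc_mul _ _ b hc (by fun_prop), ← cfc_mul (fun t : ℝ => (√t)⁻¹ * t) _ b (hc.mul (by fun_prop)) hc,
      ← cfc_one ℝ b]
    apply cfc_congr
    intro t ht
    have h0 := Real.sqrt_pos.2 (hpos t ht)
    have h1 := Real.mul_self_sqrt (hpos t ht).le
    simp only [Pi.one_apply]
    field_simp
    nlinarith

lemma fix_iso [T2Space X] (hΦ : ∀ f : C(X, ℂ), ∀ a : A, Φ f * a = a * Φ f)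
    (p v : A) (hp_sa : star p = p) (hp_idem : p * p = p) (hvp : v * p = v)
    (hs : SmallAt Φ x (star v * v - p)) :
    ∃ c : A, c * p = p * c ∧ star c = c ∧ ∃ V : Set X, IsOpen V ∧ x ∈ V ∧
      ∀ k : C(X, ℂ), (∀ y, y ∉ V → k y = 0) → Φ k * (star (v * c) * (v * c) - p) = 0 := by
  obtain ⟨U, hU, h1⟩ := hs 1 one_pos
  obtain ⟨V, hVo, hxV, h, hst, hn, hV1, hU0⟩ := cutoff hU
  have hlt := h1 h hn hU0
  have hpv : p * star v = star v := by
    have := congrArg star hvp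
    rwa [star_mul, hp_sa] at this
  have hΦs : star (Φ h) = Φ h := by rw [← map_star, hst]
  obtain ⟨c, hc, hcp, hcb⟩ := inv_sqrt (1 + Φ h * (star v * v - p)) p
    (by simp only [star_add, star_one, star_mul, star_sub, star_star, hΦs, hp_sa, ← hΦ])
    (by simpa using hlt)
    (by
      have e1 : (star v * v - p) * p = star v * v - p := by
        rw [sub_mul, mul_assoc, hvp, hp_idem]
      have e2 : p * (star v * v - p) = star v * v - p := by
        rw [mul_sub, ← mul_assoc, hpv, hp_idem]
      rw [add_mul, mul_add, mul_assoc, e1, ← mul_assoc p, ← hΦ h p, mul_assoc (Φ h) p, e2]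
      simp)
  refine ⟨c, hcp, hc, V, hVo, hxV, fun k hk => ?_⟩
  have hkh : k * h = k := by
    ext y
    by_cases hy : y ∈ V
    · simp [hV1 y hy]
    · simp [hk y hy]
  have e0 : Φ k * (1 + Φ h * (star v * v - p)) = Φ k * (1 + (star v * v - p)) := by
    rw [mul_add, mul_add, ← mul_assoc, ← map_mul, hkh]
  have e3 : p * (1 + (star v * v - p)) = star v * v := by
    rw [mul_add, mul_sub, ← mul_assoc, hpv, hp_idem]; simp
  have e4 : star (v * c) * (v * c) = c * (star v * v) * c := by
    rw [star_mul, hc]; simp only [mul_assoc]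
  rw [mul_sub, sub_eq_zero, e4, ← e3]
  calc Φ k * (c * (p * (1 + (star v * v - p))) * c)
      = (Φ k * (c * p)) * (1 + (star v * v - p)) * c := by simp only [mul_assoc]
    _ = p * c * (Φ k * (1 + (star v * v - p))) * c := by rw [hΦ, hcp]; simp only [mul_assoc]
    _ = p * Φ k * (c * (1 + Φ h * (star v * v - p)) * c) := by
        rw [← e0, ← mul_assoc (p * c), mul_assoc p c, ← hΦ]; simp only [mul_assoc]
    _ = Φ k * p := by rw [hcb, mul_one, hΦ]

lemma local_iso [T2Space X] (hΦ : ∀ f : C(X, ℂ), ∀ a : A, Φ f * a = a * Φ f)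
    (p : A) (hp_sa : star p = p) (hp_idem : p * p = p)
    (hfib : ∃ v w : A,
      star v * v - p ∈ fiberIdeal Φ x ∧ star w * w - p ∈ fiberIdeal Φ x ∧
      p * v - v ∈ fiberIdeal Φ x ∧ p * w - w ∈ fiberIdeal Φ x ∧
      star v * w ∈ fiberIdeal Φ x) :
    ∃ U : Set X, IsOpen U ∧ x ∈ U ∧ ∃ v w : A, p * v = v ∧ p * w = w ∧
      ∀ k : C(X, ℂ), (∀ y, y ∉ U → k y = 0) → Φ k * (star v * v) = Φ k * p ∧
        Φ k * (star w * w) = Φ k * p ∧ Φ k * (star v * w) = 0 := by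
  obtain ⟨v, w, h1, h2, h3, h4, h5⟩ := hfib
  replace h1 := smallAt_of_mem hΦ h1
  replace h2 := smallAt_of_mem hΦ h2
  replace h3 := smallAt_of_mem hΦ h3
  replace h4 := smallAt_of_mem hΦ h4
  replace h5 := smallAt_of_mem hΦ h5
  have pp : ∀ a, p * (p * a) = p * a := fun a => by rw [← mul_assoc, hp_idem]
  have k1 : SmallAt Φ x (star (p * v * p) * (p * v * p) - p) := by
    convert (h1.mul hΦ p p).add (h3.mul hΦ (p * star v) p) using 1
    simp only [star_mul, hp_sa, mul_sub, sub_mul, mul_assoc, pp, hp_idem]; abel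
  have k2 : SmallAt Φ x (star (p * w * p) * (p * w * p) - p) := by
    convert (h2.mul hΦ p p).add (h4.mul hΦ (p * star w) p) using 1
    simp only [star_mul, hp_sa, mul_sub, sub_mul, mul_assoc, pp, hp_idem]; abel
  have k3 : SmallAt Φ x (star (p * v * p) * (p * w * p)) := by
    convert (h5.mul hΦ p p).add (h4.mul hΦ (p * star v) p) using 1
    simp only [star_mul, hp_sa, mul_sub, sub_mul, mul_assoc, pp]; abel
  have v1 : p * (p * v * p) = p * v * p := by simp only [mul_assoc, pp]
  have v2 : (p * v * p) * p = p * v * p := by simp only [mul_assoc, hp_idem]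
  have w1 : p * (p * w * p) = p * w * p := by simp only [mul_assoc, pp]
  have w2 : (p * w * p) * p = p * w * p := by simp only [mul_assoc, hp_idem]
  generalize p * v * p = v' at *
  generalize p * w * p = w' at *
  clear h1 h2 h3 h4 h5 v w
  obtain ⟨c, hcp, hc, V, hVo, hxV, hV⟩ := fix_iso hΦ p v' hp_sa hp_idem v2 k1
  have pu : p * (v' * c) = v' * c := by rw [← mul_assoc, v1]
  have up : v' * c * p = v' * c := by rw [mul_assoc, hcp, ← mul_assoc, v2]
  have hz : SmallAt Φ x (star (v' * c) * w') := by
    rw [star_mul, mul_assoc]; exact k3.mul_left hΦ _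
  generalize v' * c = u at *
  have pz : p * (star u * w') = star u * w' := by
    have := congrArg star up
    rw [star_mul, hp_sa] at this
    rw [← mul_assoc, this]
  have zp : star u * w' * p = star u * w' := by rw [mul_assoc, w2]
  have hzs : star (star u * w') = star w' * u := by simp
  have k4 : SmallAt Φ x (star (w' - u * (star u * w')) * (w' - u * (star u * w')) - p) := by
    convert (k2.add (hz.mul_left hΦ (-star (star u * w')))).add
      ((hz.mul_left hΦ (-star (star u * w'))).add
        (hz.mul_left hΦ (star (star u * w') * star u * u))) using 1
    simp only [star_sub, star_mul, star_star, sub_mul, mul_sub, mul_assoc, neg_mul]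
    abel
  obtain ⟨d, hdp, hd, W, hWo, hxW, hW⟩ := fix_iso hΦ p (w' - u * (star u * w')) hp_sa hp_idem
    (by rw [sub_mul, w2, mul_assoc u, zp]) k4
  refine ⟨V ∩ W, hVo.inter hWo, ⟨hxV, hxW⟩, u, (w' - u * (star u * w')) * d, pu, ?_,
    fun k hk => ⟨?_, ?_, ?_⟩⟩
  · rw [← mul_assoc, mul_sub, w1, ← mul_assoc p u, pu]
  · rw [← sub_eq_zero, ← mul_sub]
    exact hV k (fun y hy => hk y (fun h => hy h.1))
  · rw [← sub_eq_zero, ← mul_sub]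
    exact hW k (fun y hy => hk y (fun h => hy h.2))
  · have e := hV k (fun y hy => hk y (fun h => hy h.1))
    have : star u * ((w' - u * (star u * w')) * d)
        = -((star u * u - p) * (star u * w' * d)) := by
      rw [sub_mul (star u * u), ← mul_assoc p, pz]
      simp only [sub_mul, mul_sub, mul_assoc]; abel
    rw [this, mul_neg, ← mul_assoc, e, zero_mul, neg_zero]

lemma words (hΦ : ∀ f : C(X, ℂ), ∀ a : A, Φ f * a = a * Φ f)
    (p : A) (U : Set X) (v w : A) (hv : p * v = v) (hw : p * w = w)
    (H : ∀ k : C(X, ℂ), (∀ y, y ∉ U → k y = 0) → Φ k * (star v * v) = Φ k * p ∧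
        Φ k * (star w * w) = Φ k * p ∧ Φ k * (star v * w) = 0) :
    ∃ s : ℕ → A, (∀ j, p * s j = s j) ∧ ∀ k : C(X, ℂ), (∀ y, y ∉ U → k y = 0) →
      ∀ i j, Φ k * (star (s i) * s j) = if i = j then Φ k * p else 0 := by
  have hps : ∀ j, p * (v ^ j * w) = v ^ j * w := by
    intro j
    cases j with
    | zero => simpa using hw
    | succ j => rw [pow_succ', mul_assoc, ← mul_assoc p, hv]
  refine ⟨fun j => v ^ j * w, hps, fun k hk i => ?_⟩
  obtain ⟨a1, a2, a3⟩ := H k hk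
  have a4 : Φ k * (star w * v) = 0 := by
    have := (H (star k) (fun y hy => by simp [hk y hy])).2.2
    have := congrArg star this
    rwa [map_star, star_mul, star_star, star_mul, star_star, star_zero, ← hΦ] at this
  induction i with
  | zero =>
    intro j
    cases j with
    | zero => simpa using a2
    | succ j =>
      simp only [pow_zero, one_mul, pow_succ', mul_assoc]
      rw [← mul_assoc (star w), ← mul_assoc, a4]; simp
  | succ i ih =>
    intro j
    cases j with
    | zero =>
      simp only [pow_zero, one_mul, pow_succ', mul_assoc, star_mul]
      rw [← mul_assoc (Φ k), hΦ, mul_assoc, ← mul_assoc (Φ k) , hΦ, mul_assoc, a3]; simp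
    | succ j =>
      have e : star (v ^ (i+1) * w) * (v ^ (j+1) * w)
          = star (v ^ i * w) * ((star v * v) * (v ^ j * w)) := by
        simp only [pow_succ', star_mul, mul_assoc]
      have := ih j
      simp only [Nat.add_right_cancel_iff]
      simp only at this
      rw [← this, e, ← mul_assoc, hΦ, mul_assoc, ← mul_assoc (Φ k), a1, mul_assoc (Φ k), hps,
        ← mul_assoc, ← hΦ, mul_assoc]

lemma pou [T2Space X] (U : X → Set X) (ho : ∀ x, IsOpen (U x)) (hx : ∀ x, x ∈ U x) :
    ∃ (n : ℕ) (f : Fin n → X) (g : Fin n → C(X, ℂ)), (∀ i, star (g i) = g i) ∧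
      (∀ i y, y ∉ U (f i) → (g i) y = 0) ∧ ∑ i, g i * g i = 1 := by
  obtain ⟨t, ht⟩ := isCompact_univ.elim_finite_subcover U ho
    (fun x _ => Set.mem_iUnion.2 ⟨x, hx x⟩)
  let e := t.equivFin.symm
  obtain ⟨ρ, hρ⟩ := PartitionOfUnity.exists_isSubordinate (s := (Set.univ : Set X)) isClosed_univ
    (fun i : Fin t.card => U (e i)) (fun i => ho _) (by
      intro y hy
      obtain ⟨x, hxt, hyx⟩ := Set.mem_iUnion₂.1 (ht hy)
      exact Set.mem_iUnion.2 ⟨e.symm ⟨x, hxt⟩, by simpa using hyx⟩)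
  refine ⟨t.card, fun i => e i, fun i => ⟨fun y => ((√(ρ i y) : ℝ) : ℂ), by fun_prop⟩, ?_, ?_, ?_⟩
  · intro i; ext y; simp
  · intro i y hy
    have : ρ i y = 0 := by
      by_contra h
      exact hy (hρ i (subset_tsupport _ h))
    simp [this]
  · ext y
    have h := ρ.sum_eq_one (Set.mem_univ y)
    rw [finsum_eq_sum_of_fintype] at h
    simp only [ContinuousMap.coe_sum, Finset.sum_apply, ContinuousMap.mul_apply,
      ContinuousMap.coe_mk, ContinuousMap.one_apply, ← Complex.ofReal_mul]
    rw [← Complex.ofReal_sum, ← Complex.ofReal_one, ← h]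
    congr 1
    exact Finset.sum_congr rfl fun i _ => Real.mul_self_sqrt (ρ.nonneg i y)

end

/-- Let `X` be a compact Hausdorff space, `A` a separable unital `C(X)`-algebra and
`p ∈ A` a projection whose image in every fibre `A_x = A / I_x` is a nonzero properly
infinite projection (i.e. for every `x` one has `p ∉ I_x` and there are `v, w ∈ A` with
`v*v - p ∈ I_x`, `w*w - p ∈ I_x`, `pv - v ∈ I_x`, `pw - w ∈ I_x` and `v*w ∈ I_x`).
Then for some positive integer `l` the projection `P = diag(p, …, p) ∈ M_l(A)` is
properly infinite: there are `V, W ∈ M_l(A)` with `V*V = P`, `W*W = P`, `PV = V`,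
`PW = W` and `V*W = 0`. -/
theorem stmt1 {X : Type*} [TopologicalSpace X] [CompactSpace X] [T2Space X]
    {A : Type*} [CStarAlgebra A] [TopologicalSpace.SeparableSpace A]
    (Φ : C(X, ℂ) →⋆ₐ[ℂ] A) (hΦ : ∀ f : C(X, ℂ), ∀ a : A, Φ f * a = a * Φ f)
    (p : A) (hp_sa : star p = p) (hp_idem : p * p = p)
    (hfib : ∀ x : X, p ∉ fiberIdeal Φ x ∧ ∃ v w : A,
      star v * v - p ∈ fiberIdeal Φ x ∧ star w * w - p ∈ fiberIdeal Φ x ∧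
      p * v - v ∈ fiberIdeal Φ x ∧ p * w - w ∈ fiberIdeal Φ x ∧
      star v * w ∈ fiberIdeal Φ x) :
    ∃ l : ℕ, 0 < l ∧ ∃ V W : Matrix (Fin l) (Fin l) A,
      star V * V = Matrix.diagonal (fun _ => p) ∧
      star W * W = Matrix.diagonal (fun _ => p) ∧
      Matrix.diagonal (fun _ => p) * V = V ∧
      Matrix.diagonal (fun _ => p) * W = W ∧
      star V * W = 0 := by
  choose hne v w H using hfib
  choose U ho hx v w hv hw H using fun x => local_iso hΦ p hp_sa hp_idem
    ⟨v x, w x, H x⟩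
  choose s hs hsk using fun x => words hΦ p (U x) (v x) (w x) (hv x) (hw x) (H x)
  obtain ⟨n, f, g, hgs, hg0, hg1⟩ := pou U ho hx
  rcases Nat.eq_zero_or_pos n with rfl | hn
  · have h10 : (1 : A) = 0 := by
      rw [← map_one Φ, ← hg1]; simp
    have : Subsingleton A := subsingleton_of_zero_eq_one h10.symm
    exact ⟨1, one_pos, 0, 0, Subsingleton.elim _ _, Subsingleton.elim _ _,
      Subsingleton.elim _ _, Subsingleton.elim _ _, Subsingleton.elim _ _⟩
  have key : ∀ a b : ℕ, ∑ i, star (Φ (g i) * s (f i) a) * (Φ (g i) * s (f i) b)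
      = if a = b then p else 0 := by
    intro a b
    have : ∀ i, star (Φ (g i) * s (f i) a) * (Φ (g i) * s (f i) b)
        = Φ (g i * g i) * (if a = b then p else 0) := by
      intro i
      have h1 := hsk (f i) (g i * g i) (fun y hy => by simp [hg0 i y hy]) a b
      rw [mul_ite, mul_zero, ← h1, star_mul, ← map_star, hgs, map_mul, ← hΦ]
      rw [mul_assoc, ← mul_assoc (star _), ← hΦ]
      simp only [mul_assoc]
    rw [Finset.sum_congr rfl fun i _ => this i, ← Finset.sum_mul, ← map_sum, hg1, map_one, one_mul]
  have pm : ∀ (i : Fin n) (a : ℕ), p * (Φ (g i) * s (f i) a) = Φ (g i) * s (f i) a := by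
    intro i a
    rw [← mul_assoc, ← hΦ, mul_assoc, hs]
  refine ⟨n, hn, Matrix.of fun i j => Φ (g i) * s (f i) j,
    Matrix.of fun i j => Φ (g i) * s (f i) (n + j), ?_, ?_, ?_, ?_, ?_⟩
  · ext a b
    simp only [Matrix.mul_apply, Matrix.star_apply, Matrix.of_apply, Matrix.diagonal_apply]
    rw [key]
    simp [Fin.ext_iff]
  · ext a b
    simp only [Matrix.mul_apply, Matrix.star_apply, Matrix.of_apply, Matrix.diagonal_apply]
    rw [key]
    simp [Fin.ext_iff]
  · ext a b
    simp only [Matrix.diagonal_mul, Matrix.of_apply, pm]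
  · ext a b
    simp only [Matrix.diagonal_mul, Matrix.of_apply, pm]
  · ext a b
    simp only [Matrix.mul_apply, Matrix.star_apply, Matrix.of_apply, Matrix.zero_apply]
    rw [key, if_neg]
    have := a.2
    omega
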